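/- Let R be a left GF-closed ring and let M be an injective left R-module. Then fd_R(M) = Gfd_R(M), i.e. the flat dimension of M equals its Gorenstein flat dimension. (The analogous statement holds for injective right R-modules over a right GF-closed ring.) -/

import Mathlib

/-!
Background definitions for D. Bennis, "Weak Gorenstein global dimensions".

Conventions.  All rings are associative with identity.  A *left* `R`-module is a type with
`[AddCommGroup M] [Module R M]`; a *right* `R`-module is a left module over the opposite ring,
i.e. `[Module Rᵐᵒᵖ M]`.  All "right-handed" notions below are obtained by applying the
corresponding "left-handed" notion to the opposite ring `Rᵐᵒᵖ`.
-/

open MulOpposite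

universe u

section Tensor

variable (S : Type u) [Ring S]

/-- The subgroup of relations defining the tensor product `A ⊗_S M` of a right `S`-module `A`
and a left `S`-module `M` over a (possibly noncommutative) ring `S`. -/
def tensorRels (A : Type u) [AddCommGroup A] [Module Sᵐᵒᵖ A]
    (M : Type u) [AddCommGroup M] [Module S M] :
    AddSubgroup (FreeAbelianGroup (A × M)) :=
  AddSubgroup.closure
    { x | (∃ a₁ a₂ m, x = FreeAbelianGroup.of (a₁ + a₂, m) - FreeAbelianGroup.of (a₁, m) -
            FreeAbelianGroup.of (a₂, m)) ∨
          (∃ a m₁ m₂, x = FreeAbelianGroup.of (a, m₁ + m₂) - FreeAbelianGroup.of (a, m₁) -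
            FreeAbelianGroup.of (a, m₂)) ∨
          (∃ (a : A) (r : S) (m : M), x = FreeAbelianGroup.of (op r • a, m) - FreeAbelianGroup.of (a, r • m)) }

/-- The tensor product `A ⊗_S M` (an abelian group) of a right `S`-module `A` and a left
`S`-module `M` over a (possibly noncommutative) ring `S`. -/
def NTensor (A : Type u) [AddCommGroup A] [Module Sᵐᵒᵖ A]
    (M : Type u) [AddCommGroup M] [Module S M] : Type u :=
  FreeAbelianGroup (A × M) ⧸ tensorRels S A M

instance (A : Type u) [AddCommGroup A] [Module Sᵐᵒᵖ A]
    (M : Type u) [AddCommGroup M] [Module S M] : AddCommGroup (NTensor S A M) :=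
  QuotientAddGroup.Quotient.addCommGroup _

namespace NTensor

variable {S}
variable {A A' : Type u} [AddCommGroup A] [Module Sᵐᵒᵖ A] [AddCommGroup A'] [Module Sᵐᵒᵖ A']
variable {M M' : Type u} [AddCommGroup M] [Module S M] [AddCommGroup M'] [Module S M']

/-- Functoriality of `A ⊗_S −` : the map `A ⊗_S M → A ⊗_S M'` induced by a linear map
`g : M → M'` of left `S`-modules. -/
def rmap (A : Type u) [AddCommGroup A] [Module Sᵐᵒᵖ A] (g : M →ₗ[S] M') :
    NTensor S A M →+ NTensor S A M' :=
  QuotientAddGroup.map (tensorRels S A M) (tensorRels S A M') (FreeAbelianGroup.map (Prod.map id g)) (by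
    simp only [tensorRels]
    refine (AddSubgroup.closure_le _).2 ?_
    rintro x (⟨a₁, a₂, m, rfl⟩ | ⟨a, m₁, m₂, rfl⟩ | ⟨a, r, m, rfl⟩) <;>
      refine SetLike.mem_coe.2 (AddSubgroup.mem_comap.2 (AddSubgroup.subset_closure ?_)) <;>
      simp only [map_sub, map_add, map_smul, FreeAbelianGroup.map_of_apply, Prod.map_apply,
        id_eq, Set.mem_setOf_eq]
    · exact Or.inl ⟨a₁, a₂, g m, rfl⟩
    · exact Or.inr (Or.inl ⟨a, g m₁, g m₂, rfl⟩)
    · exact Or.inr (Or.inr ⟨a, r, g m, rfl⟩))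

/-- Functoriality of `− ⊗_S M` : the map `A ⊗_S M → A' ⊗_S M` induced by a linear map
`f : A → A'` of right `S`-modules. -/
def lmap (M : Type u) [AddCommGroup M] [Module S M] (f : A →ₗ[Sᵐᵒᵖ] A') :
    NTensor S A M →+ NTensor S A' M :=
  QuotientAddGroup.map (tensorRels S A M) (tensorRels S A' M) (FreeAbelianGroup.map (Prod.map f id)) (by
    simp only [tensorRels]
    refine (AddSubgroup.closure_le _).2 ?_
    rintro x (⟨a₁, a₂, m, rfl⟩ | ⟨a, m₁, m₂, rfl⟩ | ⟨a, r, m, rfl⟩) <;>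
      refine SetLike.mem_coe.2 (AddSubgroup.mem_comap.2 (AddSubgroup.subset_closure ?_)) <;>
      simp only [map_sub, map_add, map_smul, FreeAbelianGroup.map_of_apply, Prod.map_apply,
        id_eq, Set.mem_setOf_eq]
    · exact Or.inl ⟨f a₁, f a₂, m, rfl⟩
    · exact Or.inr (Or.inl ⟨f a, m₁, m₂, rfl⟩)
    · exact Or.inr (Or.inr ⟨f a, r, m, rfl⟩))

end NTensor

end Tensor

section Dims

variable (S : Type u) [Ring S]

/-- A left `S`-module `M` is *flat* if tensoring with it preserves injectivity of maps of
right `S`-modules. -/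
def IsFlatMod (M : ModuleCat.{u} S) : Prop :=
  ∀ (A B : Type u) [AddCommGroup A] [Module Sᵐᵒᵖ A] [AddCommGroup B] [Module Sᵐᵒᵖ B]
    (f : A →ₗ[Sᵐᵒᵖ] B), Function.Injective f →
      Function.Injective (NTensor.lmap (↥M) f)

/-- A left `S`-module `M` is *Gorenstein flat* if there is an exact sequence
`⋯ → F (-1) → F 0 → F 1 → ⋯` of flat left `S`-modules with `M ≅ Im (F 0 → F 1)` which stays
exact after applying `I ⊗_S −` for every injective right `S`-module `I`
(a *complete flat resolution*). -/
def IsGorensteinFlat (M : ModuleCat.{u} S) : Prop :=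
  ∃ (F : ℤ → ModuleCat.{u} S) (d : ∀ n : ℤ, ↥(F n) →ₗ[S] ↥(F (n + 1))),
    (∀ n, IsFlatMod S (F n)) ∧
    (∀ n, Function.Exact (d n) (d (n + 1))) ∧
    Nonempty (↥M ≃ₗ[S] ↥(LinearMap.range (d 0))) ∧
    (∀ (I : Type u) [AddCommGroup I] [Module Sᵐᵒᵖ I], Module.Injective Sᵐᵒᵖ I →
      ∀ n, Function.Exact (NTensor.rmap I (d n)) (NTensor.rmap I (d (n + 1))))

/-- `gflatDimLE S n M` means `Gfd_S(M) ≤ n`: there is an exact sequence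
`0 → G_n → ⋯ → G_0 → M → 0` of left `S`-modules with all `G_i` Gorenstein flat. -/
def gflatDimLE : ℕ → ModuleCat.{u} S → Prop
  | 0, M => IsGorensteinFlat S M
  | n + 1, M => ∃ (K G : ModuleCat.{u} S) (ι : ↥K →ₗ[S] ↥G) (π : ↥G →ₗ[S] ↥M),
      Function.Injective ι ∧ Function.Surjective π ∧ Function.Exact ι π ∧
      IsGorensteinFlat S G ∧ gflatDimLE n K

/-- `flatDimLE S n M` means `fd_S(M) ≤ n`: there is an exact sequence
`0 → F_n → ⋯ → F_0 → M → 0` of left `S`-modules with all `F_i` flat. -/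
def flatDimLE : ℕ → ModuleCat.{u} S → Prop
  | 0, M => IsFlatMod S M
  | n + 1, M => ∃ (K F : ModuleCat.{u} S) (ι : ↥K →ₗ[S] ↥F) (π : ↥F →ₗ[S] ↥M),
      Function.Injective ι ∧ Function.Surjective π ∧ Function.Exact ι π ∧
      IsFlatMod S F ∧ flatDimLE n K

/-- `injDimLE S n M` means `id_S(M) ≤ n`: there is an exact sequence
`0 → M → I^0 → ⋯ → I^n → 0` of left `S`-modules with all `I^i` injective. -/
def injDimLE : ℕ → ModuleCat.{u} S → Prop
  | 0, M => Module.Injective S ↥M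
  | n + 1, M => ∃ (I C : ModuleCat.{u} S) (ι : ↥M →ₗ[S] ↥I) (π : ↥I →ₗ[S] ↥C),
      Function.Injective ι ∧ Function.Surjective π ∧ Function.Exact ι π ∧
      Module.Injective S ↥I ∧ injDimLE n C

/-- The Gorenstein flat dimension `Gfd_S(M) ∈ ℕ∞` of a left `S`-module `M`. -/
noncomputable def gflatDim (M : ModuleCat.{u} S) : ℕ∞ :=
  sInf {d : ℕ∞ | ∃ n : ℕ, d = n ∧ gflatDimLE S n M}

/-- The flat dimension `fd_S(M) ∈ ℕ∞` of a left `S`-module `M`. -/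
noncomputable def flatDim (M : ModuleCat.{u} S) : ℕ∞ :=
  sInf {d : ℕ∞ | ∃ n : ℕ, d = n ∧ flatDimLE S n M}

/-- The injective dimension `id_S(M) ∈ ℕ∞` of a left `S`-module `M`. -/
noncomputable def injDim (M : ModuleCat.{u} S) : ℕ∞ :=
  sInf {d : ℕ∞ | ∃ n : ℕ, d = n ∧ injDimLE S n M}

/-- The left weak Gorenstein global dimension
`l.Gwdim(S) = sup { Gfd_S(M) | M a left S-module }`.  The right weak Gorenstein global
dimension of `S` is `gorensteinWeakGlobalDim Sᵐᵒᵖ`. -/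
noncomputable def gorensteinWeakGlobalDim : ℕ∞ :=
  ⨆ M : ModuleCat.{u} S, gflatDim S M

/-- The left weak global dimension `sup { fd_S(M) | M a left S-module }`.  (By a classical
theorem it agrees with `weakGlobalDim Sᵐᵒᵖ`, and the common value is `wdim S`.) -/
noncomputable def weakGlobalDim : ℕ∞ :=
  ⨆ M : ModuleCat.{u} S, flatDim S M

/-- The left finitistic flat dimension
`l.FFD(S) = sup { fd_S(M) | M a left S-module with fd_S(M) < ∞ }`. -/
noncomputable def finitisticFlatDim : ℕ∞ :=
  sSup {d : ℕ∞ | d ≠ ⊤ ∧ ∃ M : ModuleCat.{u} S, flatDim S M = d}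

/-- The left finitistic Gorenstein flat dimension
`l.FGFD(S) = sup { Gfd_S(M) | M a left S-module with Gfd_S(M) < ∞ }`. -/
noncomputable def finitisticGFlatDim : ℕ∞ :=
  sSup {d : ℕ∞ | d ≠ ⊤ ∧ ∃ M : ModuleCat.{u} S, gflatDim S M = d}

/-- A ring `S` is *left GF-closed* if the class of Gorenstein flat left `S`-modules is closed
under extensions.  `S` is right GF-closed iff `Sᵐᵒᵖ` is left GF-closed, and GF-closed if both. -/
def IsGFClosed : Prop :=
  ∀ (A B C : ModuleCat.{u} S) (f : ↥A →ₗ[S] ↥B) (g : ↥B →ₗ[S] ↥C),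
    Function.Injective f → Function.Surjective g → Function.Exact f g →
      IsGorensteinFlat S A → IsGorensteinFlat S C → IsGorensteinFlat S B

/-- A ring `S` is *left coherent* if every finitely generated left ideal of `S` is finitely
presented (as a left `S`-module).  `S` is right coherent iff `Sᵐᵒᵖ` is left coherent. -/
def IsLeftCoherent : Prop :=
  ∀ I : Submodule S S, I.FG → Module.FinitePresentation S ↥I

/-- A ring `S` is *left IF* if every injective left `S`-module is flat.  `S` is right IF iff
`Sᵐᵒᵖ` is left IF, and IF if both. -/
def IsLeftIF : Prop :=
  ∀ E : ModuleCat.{u} S, Module.Injective S ↥E → IsFlatMod S E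

/-- A ring `S` is *left `n`-IF* if `fd_S(E) ≤ n` for every injective left `S`-module `E`.
`S` is right `n`-IF iff `Sᵐᵒᵖ` is left `n`-IF, and `n`-IF if both. -/
def IsLeftNIF (n : ℕ) : Prop :=
  ∀ E : ModuleCat.{u} S, Module.Injective S ↥E → flatDim S E ≤ (n : ℕ∞)

/-- `Ext¹_S(T, K) = 0`, expressed by its standard characterization: every extension of `T`
by `K` (i.e. every short exact sequence `0 → K → X → T → 0`) splits. -/
def Ext1Zero (T K : ModuleCat.{u} S) : Prop :=
  ∀ (X : ModuleCat.{u} S) (ι : ↥K →ₗ[S] ↥X) (π : ↥X →ₗ[S] ↥T),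
    Function.Injective ι → Function.Surjective π → Function.Exact ι π →
      ∃ ρ : ↥X →ₗ[S] ↥K, ρ.comp ι = LinearMap.id

/-- A left `S`-module `K` is *cotorsion* if `Ext¹_S(F, K) = 0` for every flat left
`S`-module `F`. -/
def IsCotorsion (K : ModuleCat.{u} S) : Prop :=
  ∀ F : ModuleCat.{u} S, IsFlatMod S F → Ext1Zero S F K

/-- `Tor₁^S(A, T) = 0` for a right `S`-module `A` and a left `S`-module `T`, expressed by its
standard characterization: for every short exact sequence `0 → K → F → T → 0` of left
`S`-modules with `F` flat, the induced map `A ⊗_S K → A ⊗_S F` is injective. -/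
def Tor1Zero (A : Type u) [AddCommGroup A] [Module Sᵐᵒᵖ A] (T : ModuleCat.{u} S) : Prop :=
  ∀ (K F : ModuleCat.{u} S) (ι : ↥K →ₗ[S] ↥F) (π : ↥F →ₗ[S] ↥T),
    IsFlatMod S F → Function.Injective ι → Function.Surjective π → Function.Exact ι π →
      Function.Injective (NTensor.rmap A ι)

/-- A left `S`-module is *finitely presented* if it admits a presentation with finitely many
generators and relations. -/
abbrev IsFinitelyPresented (M : ModuleCat.{u} S) : Prop :=
  Module.FinitePresentation S ↥M

end Dims

open CategoryTheory

namespace NTensor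

variable {S : Type u} [Ring S]
variable {A : Type u} [AddCommGroup A] [Module Sᵐᵒᵖ A]
variable {M M' : Type u} [AddCommGroup M] [Module S M] [AddCommGroup M'] [Module S M']

/-- The pure tensor `a ⊗ m`. -/
def tmul (a : A) (m : M) : NTensor S A M :=
  QuotientAddGroup.mk' (tensorRels S A M) (FreeAbelianGroup.of (a, m))

theorem add_tmul (a₁ a₂ : A) (m : M) :
    (tmul (a₁ + a₂) m : NTensor S A M) = tmul a₁ m + tmul a₂ m := by
  rw [← sub_eq_zero, ← sub_sub]
  exact (QuotientAddGroup.eq_zero_iff _).2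
    (AddSubgroup.subset_closure (Or.inl ⟨a₁, a₂, m, rfl⟩))

theorem tmul_add (a : A) (m₁ m₂ : M) :
    (tmul a (m₁ + m₂) : NTensor S A M) = tmul a m₁ + tmul a m₂ := by
  rw [← sub_eq_zero, ← sub_sub]
  exact (QuotientAddGroup.eq_zero_iff _).2
    (AddSubgroup.subset_closure (Or.inr (Or.inl ⟨a, m₁, m₂, rfl⟩)))

theorem smul_tmul (a : A) (r : S) (m : M) :
    (tmul (op r • a) m : NTensor S A M) = tmul a (r • m) := by
  rw [← sub_eq_zero]
  exact (QuotientAddGroup.eq_zero_iff _).2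
    (AddSubgroup.subset_closure (Or.inr (Or.inr ⟨a, r, m, rfl⟩)))

theorem hom_ext {B : Type*} [AddCommGroup B] {f g : NTensor S A M →+ B}
    (h : ∀ a m, f (tmul a m) = g (tmul a m)) : f = g := by
  refine QuotientAddGroup.addMonoidHom_ext _ (FreeAbelianGroup.lift_ext _ _ ?_)
  rintro ⟨a, m⟩
  exact h a m

/-- The additive map out of `A ⊗_S M` induced by a balanced biadditive map. -/
def lift {B : Type*} [AddCommGroup B] (φ : A →+ M →+ B)
    (hφ : ∀ a (r : S) m, φ (op r • a) m = φ a (r • m)) : NTensor S A M →+ B :=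
  QuotientAddGroup.lift (tensorRels S A M) (FreeAbelianGroup.lift fun p => φ p.1 p.2) (by
    refine (AddSubgroup.closure_le _).2 ?_
    rintro x (⟨a₁, a₂, m, rfl⟩ | ⟨a, m₁, m₂, rfl⟩ | ⟨a, r, m, rfl⟩) <;>
      simp [hφ])

theorem lift_tmul {B : Type*} [AddCommGroup B] (φ : A →+ M →+ B)
    (hφ : ∀ a (r : S) m, φ (op r • a) m = φ a (r • m)) (a : A) (m : M) :
    lift φ hφ (tmul a m) = φ a m :=
  FreeAbelianGroup.lift_apply_of _ _

theorem lmap_tmul {A' : Type u} [AddCommGroup A'] [Module Sᵐᵒᵖ A'] (f : A →ₗ[Sᵐᵒᵖ] A')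
    (a : A) (m : M) : lmap M f (tmul a m) = tmul (f a) m :=
  rfl

theorem rmap_comp {M'' : Type u} [AddCommGroup M''] [Module S M''] (g : M →ₗ[S] M')
    (g' : M' →ₗ[S] M'') : rmap A (g' ∘ₗ g) = (rmap A g').comp (rmap A g) :=
  hom_ext fun _ _ => rfl

theorem rmap_id : rmap A (LinearMap.id : M →ₗ[S] M) = AddMonoidHom.id _ :=
  hom_ext fun _ _ => rfl

theorem rmap_add (g g' : M →ₗ[S] M') : rmap A (g + g') = rmap A g + rmap A g' :=
  hom_ext fun a m => tmul_add a (g m) (g' m)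

theorem rmap_zero : rmap A (0 : M →ₗ[S] M') = 0 := by
  simpa using rmap_add (A := A) (0 : M →ₗ[S] M') 0

end NTensor

/-- The character module `Hom_ℤ(M, ℚ/ℤ)` of a left `S`-module, as a right `S`-module. -/
def RightDual (S : Type u) [Ring S] (M : Type u) [AddCommGroup M] [Module S M] : Type u :=
  M →+ AddCircle (1 : ℚ)

namespace RightDual

variable {S : Type u} [Ring S]
variable {M N P : Type u} [AddCommGroup M] [Module S M] [AddCommGroup N] [Module S N]
  [AddCommGroup P] [Module S P]

instance : AddCommGroup (RightDual S M) :=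
  inferInstanceAs (AddCommGroup (M →+ AddCircle (1 : ℚ)))

instance : FunLike (RightDual S M) M (AddCircle (1 : ℚ)) :=
  inferInstanceAs (FunLike (M →+ AddCircle (1 : ℚ)) M (AddCircle (1 : ℚ)))

instance : AddMonoidHomClass (RightDual S M) M (AddCircle (1 : ℚ)) :=
  inferInstanceAs (AddMonoidHomClass (M →+ AddCircle (1 : ℚ)) M (AddCircle (1 : ℚ)))

@[ext] theorem ext {φ ψ : RightDual S M} (h : ∀ m, φ m = ψ m) : φ = ψ :=
  DFunLike.ext _ _ h

@[simp] theorem add_apply (φ ψ : RightDual S M) (m : M) : (φ + ψ) m = φ m + ψ m := rfl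

@[simp] theorem zero_apply (m : M) : (0 : RightDual S M) m = 0 := rfl

instance : SMul Sᵐᵒᵖ (RightDual S M) where
  smul r φ := AddMonoidHom.comp φ (DistribSMul.toAddMonoidHom M r.unop)

@[simp] theorem smul_apply (r : Sᵐᵒᵖ) (φ : RightDual S M) (m : M) :
    (r • φ) m = φ (r.unop • m) := rfl

instance : Module Sᵐᵒᵖ (RightDual S M) where
  one_smul φ := by ext; simp
  mul_smul r s φ := by ext; simp [mul_smul]
  smul_zero r := by ext; simp
  smul_add r φ ψ := by ext; simp
  add_smul r s φ := by ext; simp [add_smul]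
  zero_smul φ := by ext; simp

/-- Precomposition with a linear map, as a map of character modules. -/
def map (f : M →ₗ[S] N) : RightDual S N →ₗ[Sᵐᵒᵖ] RightDual S M where
  toFun φ := AddMonoidHom.comp φ f.toAddMonoidHom
  map_add' _ _ := rfl
  map_smul' r φ := by
    ext m
    exact congrArg φ (f.map_smul r.unop m).symm

@[simp] theorem map_apply (f : M →ₗ[S] N) (φ : RightDual S N) (m : M) :
    map f φ m = φ (f m) := rfl

theorem map_injective {f : M →ₗ[S] N} (hf : Function.Surjective f) :
    Function.Injective (map f) := by
  intro φ ψ h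
  ext n
  obtain ⟨m, rfl⟩ := hf n
  exact DFunLike.congr_fun h m

theorem exists_extension {A B : Type*} [AddCommGroup A] [AddCommGroup B] (f : A →+ B)
    (hf : Function.Injective f) (g : A →+ AddCircle (1 : ℚ)) :
    ∃ h : B →+ AddCircle (1 : ℚ), ∀ a, h (f a) = g a := by
  obtain ⟨h, hh⟩ := (Module.Baer.of_divisible _).extension_property_addMonoidHom f hf g
  exact ⟨h, DFunLike.congr_fun hh⟩

theorem map_surjective {f : M →ₗ[S] N} (hf : Function.Injective f) :
    Function.Surjective (map f) := by
  intro φ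
  obtain ⟨h, hh⟩ := exists_extension f.toAddMonoidHom hf φ
  exact ⟨h, ext hh⟩

theorem map_exact {f : M →ₗ[S] N} {g : N →ₗ[S] P} (hg : Function.Surjective g)
    (hfg : Function.Exact f g) : Function.Exact (map g) (map f) := by
  intro φ
  constructor
  · intro hφ
    let φ' : N →+ AddCircle (1 : ℚ) := φ
    have hker : g.toAddMonoidHom.ker ≤ φ'.ker := by
      intro n hn
      obtain ⟨m, rfl⟩ := (hfg n).1 hn
      exact DFunLike.congr_fun hφ m
    refine ⟨g.toAddMonoidHom.liftOfSurjective hg ⟨φ', hker⟩, ext fun n => ?_⟩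
    exact AddMonoidHom.liftOfRightInverse_comp_apply _ _ (Function.rightInverse_surjInv hg)
      ⟨φ', hker⟩ n
  · rintro ⟨ψ, rfl⟩
    ext m
    simp [hfg.apply_apply_eq_zero]

theorem shortExact {f : M →ₗ[S] N} {g : N →ₗ[S] P} (hf : Function.Injective f)
    (hg : Function.Surjective g) (hfg : Function.Exact f g) :
    (ShortComplex.mk (ModuleCat.ofHom (map g)) (ModuleCat.ofHom (map f)) (by
      rw [← ModuleCat.ofHom_comp, (map_exact hg hfg).linearMap_comp_eq_zero]
      rfl)).ShortExact :=
  ModuleCat.shortComplex_shortExact _ (map_exact hg hfg) (map_injective hg) (map_surjective hf)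

end RightDual

section Flat

variable {S : Type u} [Ring S]

/-- Lambek's criterion. -/
theorem isFlatMod_iff_injective_rightDual (M : ModuleCat.{u} S) :
    IsFlatMod S M ↔ Module.Injective Sᵐᵒᵖ (RightDual S M) := by
  constructor
  · refine fun hM => ⟨fun A B _ _ _ _ f hf g => ?_⟩
    let G : A →+ M →+ AddCircle (1 : ℚ) := g.toAddMonoidHom
    have hG : ∀ a (r : S) m, G (op r • a) m = G a (r • m) := fun a r m =>
      DFunLike.congr_fun (g.map_smul (op r) a) m
    obtain ⟨h, hh⟩ := RightDual.exists_extension _ (hM A B f hf) (NTensor.lift G hG)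
    refine ⟨
      { toFun := fun b => AddMonoidHom.mk' (fun m => h (NTensor.tmul b m)) fun m₁ m₂ => by
          rw [NTensor.tmul_add, map_add]
        map_add' := fun b₁ b₂ => RightDual.ext fun m => ?_
        map_smul' := fun r b => RightDual.ext fun m => ?_ }, fun a => RightDual.ext fun m => ?_⟩
    · exact (congrArg h (NTensor.add_tmul b₁ b₂ m)).trans (map_add h _ _)
    · exact congrArg h (NTensor.smul_tmul b r.unop m)
    · exact (hh (NTensor.tmul a m)).trans (NTensor.lift_tmul G hG a m)
  · intro hM A B _ _ _ _ f hf
    refine (injective_iff_map_eq_zero _).2 fun x hx => ?_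
    refine CharacterModule.eq_zero_of_character_apply fun χ => ?_
    let χ' : NTensor S A M →+ AddCircle (1 : ℚ) := χ
    let g : A →ₗ[Sᵐᵒᵖ] RightDual S M :=
      { toFun := fun a => AddMonoidHom.mk' (fun m => χ' (NTensor.tmul a m)) fun m₁ m₂ => by
          rw [NTensor.tmul_add, map_add]
        map_add' := fun b₁ b₂ => RightDual.ext fun m =>
          (congrArg χ' (NTensor.add_tmul b₁ b₂ m)).trans (map_add χ' _ _)
        map_smul' := fun r b => RightDual.ext fun m =>
          congrArg χ' (NTensor.smul_tmul b r.unop m) }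
    obtain ⟨h, hh⟩ := hM.out f hf g
    let H : B →+ M →+ AddCircle (1 : ℚ) := h.toAddMonoidHom
    have hH : ∀ b (r : S) m, H (op r • b) m = H b (r • m) := fun b r m =>
      DFunLike.congr_fun (h.map_smul (op r) b) m
    have key : (NTensor.lift H hH).comp (NTensor.lmap M f) = χ' := by
      refine NTensor.hom_ext fun a m => ?_
      rw [AddMonoidHom.comp_apply, NTensor.lmap_tmul, NTensor.lift_tmul]
      exact DFunLike.congr_fun (hh a) m
    change χ' x = 0
    rw [← key, AddMonoidHom.comp_apply, hx, map_zero]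

theorem isFlatMod_finsupp (X : Type u) : IsFlatMod S (ModuleCat.of S (X →₀ S)) := by
  refine (isFlatMod_iff_injective_rightDual _).2 ⟨fun A B _ _ _ _ f hf g => ?_⟩
  have hext (x : X) : ∃ h : B →+ AddCircle (1 : ℚ), ∀ a,
      h (f a) = g a (Finsupp.single x 1) :=
    RightDual.exists_extension f.toAddMonoidHom hf
      (AddMonoidHom.mk' (fun a => g a (Finsupp.single x 1)) fun a b => by
        rw [map_add, RightDual.add_apply])
  choose h hh using hext
  let G (b : B) : (X →₀ S) →+ AddCircle (1 : ℚ) := Finsupp.liftAddHom fun x =>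
    AddMonoidHom.mk' (fun r : S => h x (op r • b)) fun r s => by
      rw [MulOpposite.op_add, add_smul, map_add]
  have hG (b : B) (x : X) (r : S) : G b (Finsupp.single x r) = h x (op r • b) := by
    simp [G]
  refine ⟨
    { toFun := G
      map_add' := fun b₁ b₂ => ?_
      map_smul' := fun s b => ?_ }, fun a => ?_⟩
  · refine Finsupp.addHom_ext (f := G (b₁ + b₂)) (g := G b₁ + G b₂) fun x r => ?_
    rw [AddMonoidHom.add_apply, hG, hG, hG, smul_add, map_add]
  · refine Finsupp.addHom_ext (f := G (s • b))
      (g := (G b).comp (DistribSMul.toAddMonoidHom _ s.unop)) fun x r => ?_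
    rw [AddMonoidHom.comp_apply, DistribSMul.toAddMonoidHom_apply, Finsupp.smul_single, hG, hG,
      smul_smul, smul_eq_mul, MulOpposite.op_mul, op_unop]
  · refine Finsupp.addHom_ext (f := G (f a)) (g := (g a : (X →₀ S) →+ _)) fun x r => ?_
    rw [hG, ← map_smul, hh, map_smul, RightDual.smul_apply]
    simp only [unop_op, Finsupp.smul_single, smul_eq_mul, mul_one]
    rfl

theorem isFlatMod_prod {M N : ModuleCat.{u} S} (hM : IsFlatMod S M) (hN : IsFlatMod S N) :
    IsFlatMod S (ModuleCat.of S (M × N)) := by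
  rw [isFlatMod_iff_injective_rightDual] at hM hN ⊢
  refine ⟨fun A B _ _ _ _ f hf g => ?_⟩
  obtain ⟨h₁, hh₁⟩ := hM.out f hf (RightDual.map (LinearMap.inl S M N) ∘ₗ g)
  obtain ⟨h₂, hh₂⟩ := hN.out f hf (RightDual.map (LinearMap.inr S M N) ∘ₗ g)
  refine ⟨RightDual.map (LinearMap.fst S M N) ∘ₗ h₁ + RightDual.map (LinearMap.snd S M N) ∘ₗ h₂,
    fun a => RightDual.ext ?_⟩
  rintro ⟨m, n⟩
  have hm : h₁ (f a) m = g a (m, 0) := DFunLike.congr_fun (hh₁ a) m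
  have hn : h₂ (f a) n = g a (0, n) := DFunLike.congr_fun (hh₂ a) n
  change h₁ (f a) m + h₂ (f a) n = g a (m, n)
  rw [hm, hn, ← map_add]
  simp

theorem isFlatMod_iff_hasInjectiveDimensionLT (M : ModuleCat.{u} S) :
    IsFlatMod S M ↔ HasInjectiveDimensionLT (ModuleCat.of Sᵐᵒᵖ (RightDual S M)) 1 := by
  rw [isFlatMod_iff_injective_rightDual, Module.injective_iff_injective_object,
    injective_iff_hasInjectiveDimensionLT_one]

theorem flatDimLE_iff_hasInjectiveDimensionLT (n : ℕ) (M : ModuleCat.{u} S) :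
    flatDimLE S n M ↔
      HasInjectiveDimensionLT (ModuleCat.of Sᵐᵒᵖ (RightDual S M)) (n + 1) := by
  induction n generalizing M with
  | zero => exact isFlatMod_iff_hasInjectiveDimensionLT M
  | succ n ih =>
    constructor
    · rintro ⟨K, F, ι, π, hι, hπ, hex, hF, hK⟩
      have hF' := (isFlatMod_iff_hasInjectiveDimensionLT F).1 hF
      exact ((RightDual.shortExact hι hπ hex).hasInjectiveDimensionLT_X₃_iff n
        (injective_iff_hasInjectiveDimensionLT_one.2 hF')).1 ((ih K).1 hK)
    · intro hM
      let π : (M →₀ S) →ₗ[S] M := Finsupp.linearCombination S id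
      have hπ : Function.Surjective π := Finsupp.linearCombination_id_surjective S M
      have hι := (LinearMap.ker π).subtype_injective
      have hex := LinearMap.exact_subtype_ker_map π
      have hF := isFlatMod_finsupp (S := S) M
      have hF' := (isFlatMod_iff_hasInjectiveDimensionLT _).1 hF
      refine ⟨ModuleCat.of S (LinearMap.ker π), ModuleCat.of S (M →₀ S),
        (LinearMap.ker π).subtype, π, hι, hπ, hex, hF, (ih _).2 ?_⟩
      exact ((RightDual.shortExact hι hπ hex).hasInjectiveDimensionLT_X₃_iff n
        (injective_iff_hasInjectiveDimensionLT_one.2 hF')).2 hM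

theorem flatDimLE_of_retract {n : ℕ} {M N : ModuleCat.{u} S} (i : M →ₗ[S] N) (r : N →ₗ[S] M)
    (hri : ∀ m, r (i m) = m) (hN : flatDimLE S n N) : flatDimLE S n M := by
  rw [flatDimLE_iff_hasInjectiveDimensionLT] at hN ⊢
  let e : Retract (ModuleCat.of Sᵐᵒᵖ (RightDual S M)) (ModuleCat.of Sᵐᵒᵖ (RightDual S N)) :=
    { i := ModuleCat.ofHom (RightDual.map r)
      r := ModuleCat.ofHom (RightDual.map i)
      retract := by
        refine ModuleCat.hom_ext (LinearMap.ext fun φ => ?_)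
        exact RightDual.ext (S := S) fun m => congrArg (φ : RightDual S M) (hri m) }
  exact e.hasInjectiveDimensionLT (n + 1)

end Flat

section GorensteinFlat

variable {S : Type u} [Ring S]

theorem IsFlatMod.isGorensteinFlat {M : ModuleCat.{u} S} (hM : IsFlatMod S M) :
    IsGorensteinFlat S M := by
  let d : (M × M) →ₗ[S] M × M := LinearMap.inl S M M ∘ₗ LinearMap.snd S M M
  let s : (M × M) →ₗ[S] M × M := LinearMap.inr S M M ∘ₗ LinearMap.fst S M M
  have hdd : d ∘ₗ d = 0 := by ext <;> simp [d]
  have hds : d ∘ₗ s + s ∘ₗ d = LinearMap.id := by ext <;> simp [d, s]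
  refine ⟨fun _ => ModuleCat.of S (M × M), fun _ => d, fun _ => isFlatMod_prod hM hM, fun _ => ?_,
    ⟨?_⟩, fun I _ _ _ _ => ?_⟩
  · refine fun x => ⟨fun hx => ⟨s x, ?_⟩, ?_⟩
    · have := LinearMap.congr_fun hds x
      simpa [hx] using this
    · rintro ⟨y, rfl⟩
      exact LinearMap.congr_fun hdd y
  · have hr : LinearMap.range d = LinearMap.range (LinearMap.inl S M M) :=
      LinearMap.range_comp_of_range_eq_top _ (LinearMap.range_eq_top.2 Prod.snd_surjective)
    exact (LinearEquiv.ofInjective (LinearMap.inl S M M) LinearMap.inl_injective).trans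
      (LinearEquiv.ofEq _ _ hr.symm)
  · refine fun x => ⟨fun hx => ⟨NTensor.rmap I s x, ?_⟩, ?_⟩
    · have := DFunLike.congr_fun (congrArg (NTensor.rmap I) hds) x
      rw [NTensor.rmap_add, NTensor.rmap_comp s d, NTensor.rmap_comp d s, NTensor.rmap_id] at this
      have hx' : NTensor.rmap I d x = 0 := hx
      simpa [hx'] using this
    · rintro ⟨y, rfl⟩
      have := DFunLike.congr_fun (congrArg (NTensor.rmap I) hdd) y
      rwa [NTensor.rmap_comp, NTensor.rmap_zero] at this

theorem gflatDimLE_of_flatDimLE {n : ℕ} {M : ModuleCat.{u} S} (hM : flatDimLE S n M) :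
    gflatDimLE S n M := by
  induction n generalizing M with
  | zero => exact IsFlatMod.isGorensteinFlat hM
  | succ n ih =>
    obtain ⟨K, F, ι, π, hι, hπ, hex, hF, hK⟩ := hM
    exact ⟨K, F, ι, π, hι, hπ, hex, hF.isGorensteinFlat, ih hK⟩

theorem IsGorensteinFlat.exists_embedding_flat {M : ModuleCat.{u} S}
    (hM : IsGorensteinFlat S M) :
    ∃ (F G : ModuleCat.{u} S) (ι : M →ₗ[S] F) (π : F →ₗ[S] G),
      Function.Injective ι ∧ Function.Surjective π ∧ Function.Exact ι π ∧
      IsFlatMod S F ∧ IsGorensteinFlat S G := by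
  obtain ⟨F, d, hF, hd, ⟨e⟩, hI⟩ := hM
  refine ⟨F (0 + 1), ModuleCat.of S (LinearMap.range (d (0 + 1))),
    (LinearMap.range (d 0)).subtype ∘ₗ e.toLinearMap, (d (0 + 1)).rangeRestrict,
    (LinearMap.range (d 0)).subtype_injective.comp e.injective,
    (d (0 + 1)).surjective_rangeRestrict, fun x => ?_, hF _, ?_⟩
  · have h₁ : (d (0 + 1)).rangeRestrict x = 0 ↔ d (0 + 1) x = 0 := Subtype.ext_iff
    refine h₁.trans ((hd 0 x).trans ⟨fun hx => ⟨e.symm ⟨x, hx⟩, by simp⟩, ?_⟩)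
    rintro ⟨m, rfl⟩
    exact (e m).2
  · exact ⟨fun n => F (n + 1), fun n => d (n + 1), fun n => hF _, fun n => hd _,
      ⟨LinearEquiv.refl S _⟩, fun I _ _ hinj n => hI I hinj _⟩

/-- The pushout of two monomorphisms, with the cokernels of its legs. -/
theorem exists_pushout {K G H M C : ModuleCat.{u} S} {ι : K →ₗ[S] G} {π : G →ₗ[S] M}
    {j : K →ₗ[S] H} {q : H →ₗ[S] C} (hι : Function.Injective ι) (hπ : Function.Surjective π)
    (hιπ : Function.Exact ι π) (hj : Function.Injective j) (hq : Function.Surjective q)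
    (hjq : Function.Exact j q) :
    ∃ (P : ModuleCat.{u} S) (α : G →ₗ[S] P) (γ : P →ₗ[S] C) (β : H →ₗ[S] P) (δ : P →ₗ[S] M),
      (Function.Injective α ∧ Function.Surjective γ ∧ Function.Exact α γ) ∧
      (Function.Injective β ∧ Function.Surjective δ ∧ Function.Exact β δ) := by
  let N : Submodule S (G × H) := LinearMap.range (ι.prod (-j))
  have hN (g : G) (h : H) : (g, h) ∈ N ↔ ∃ k, ι k = g ∧ -j k = h := by
    simp [N, Prod.ext_iff]
  have hγ : N ≤ LinearMap.ker (q ∘ₗ LinearMap.snd S G H) := by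
    rintro ⟨g, h⟩ hgh
    obtain ⟨k, rfl, rfl⟩ := (hN _ _).1 hgh
    simp [hjq.apply_apply_eq_zero]
  have hδ : N ≤ LinearMap.ker (π ∘ₗ LinearMap.fst S G H) := by
    rintro ⟨g, h⟩ hgh
    obtain ⟨k, rfl, rfl⟩ := (hN _ _).1 hgh
    simp [hιπ.apply_apply_eq_zero]
  refine ⟨ModuleCat.of S ((G × H) ⧸ N), N.mkQ ∘ₗ LinearMap.inl S G H, N.liftQ _ hγ,
    N.mkQ ∘ₗ LinearMap.inr S G H, N.liftQ _ hδ, ⟨?_, ?_, ?_⟩, ⟨?_, ?_, ?_⟩⟩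
  · refine (injective_iff_map_eq_zero _).2 fun g hg => ?_
    obtain ⟨k, rfl, hk⟩ := (hN g 0).1 ((Submodule.Quotient.mk_eq_zero N).1 hg)
    rw [neg_eq_zero, map_eq_zero_iff j hj] at hk
    rw [hk, map_zero]
  · intro c
    obtain ⟨h, rfl⟩ := hq c
    exact ⟨N.mkQ (0, h), rfl⟩
  · intro x
    obtain ⟨⟨g, h⟩, rfl⟩ := N.mkQ_surjective x
    change q h = 0 ↔ _
    constructor
    · intro hh
      obtain ⟨k, rfl⟩ := (hjq h).1 hh
      refine ⟨g + ι k, (Submodule.Quotient.eq N).2 ((hN _ _).2 ⟨k, ?_, ?_⟩)⟩ <;> simp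
    · rintro ⟨g', hg'⟩
      obtain ⟨k, -, hk⟩ := (hN _ _).1 ((Submodule.Quotient.eq N).1 hg')
      obtain rfl : j k = h := by simpa using hk
      exact hjq.apply_apply_eq_zero k
  · refine (injective_iff_map_eq_zero _).2 fun h hh => ?_
    obtain ⟨k, hk, rfl⟩ := (hN 0 h).1 ((Submodule.Quotient.mk_eq_zero N).1 hh)
    rw [map_eq_zero_iff ι hι] at hk
    rw [hk, map_zero, neg_zero]
  · intro m
    obtain ⟨g, rfl⟩ := hπ m
    exact ⟨N.mkQ (g, 0), rfl⟩
  · intro x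
    obtain ⟨⟨g, h⟩, rfl⟩ := N.mkQ_surjective x
    change π g = 0 ↔ _
    constructor
    · intro hg
      obtain ⟨k, rfl⟩ := (hιπ g).1 hg
      refine ⟨h + j k, (Submodule.Quotient.eq N).2 ((hN _ _).2 ⟨-k, ?_, ?_⟩)⟩ <;> simp
    · rintro ⟨h', hh'⟩
      obtain ⟨k, hk, -⟩ := (hN _ _).1 ((Submodule.Quotient.eq N).1 hh')
      obtain rfl : ι (-k) = g := by rw [map_neg, hk]; simp
      exact hιπ.apply_apply_eq_zero _

/-- For submodules `H ≤ P ≤ F` with `P / H ≅ M` and `F / P ≅ G`, the exact sequence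
`0 → M → F / H → G → 0`. -/
theorem exists_quotient_embedding {H P M F G : ModuleCat.{u} S} {β : H →ₗ[S] P}
    {δ : P →ₗ[S] M} {κ : P →ₗ[S] F} {ρ : F →ₗ[S] G} (hδ : Function.Surjective δ)
    (hβδ : Function.Exact β δ) (hκ : Function.Injective κ) (hρ : Function.Surjective ρ)
    (hκρ : Function.Exact κ ρ) :
    ∃ (i : M →ₗ[S] F ⧸ LinearMap.range (κ ∘ₗ β)) (p : (F ⧸ LinearMap.range (κ ∘ₗ β)) →ₗ[S] G),
      Function.Injective i ∧ Function.Surjective p ∧ Function.Exact i p := by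
  let N := LinearMap.range (κ ∘ₗ β)
  have hker : LinearMap.ker δ ≤ LinearMap.ker (N.mkQ ∘ₗ κ) := by
    intro x hx
    obtain ⟨h, rfl⟩ := (hβδ x).1 hx
    exact (Submodule.Quotient.mk_eq_zero N).2 ⟨h, rfl⟩
  let i : M →ₗ[S] F ⧸ N :=
    (LinearMap.ker δ).liftQ _ hker ∘ₗ (δ.quotKerEquivOfSurjective hδ).symm.toLinearMap
  have hi (x : P) : i (δ x) = N.mkQ (κ x) := by
    have : (δ.quotKerEquivOfSurjective hδ).symm (δ x) = (LinearMap.ker δ).mkQ x :=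
      (LinearEquiv.symm_apply_eq _).2 rfl
    simp [i, this]
  have hNρ : N ≤ LinearMap.ker ρ := by
    rintro _ ⟨h, rfl⟩
    exact hκρ.apply_apply_eq_zero _
  refine ⟨i, N.liftQ ρ hNρ, (injective_iff_map_eq_zero _).2 fun m hm => ?_, fun g => ?_,
    fun x => ?_⟩
  · obtain ⟨x, rfl⟩ := hδ m
    rw [hi] at hm
    obtain ⟨h, hh⟩ := (Submodule.Quotient.mk_eq_zero N).1 hm
    rw [← hκ hh]
    exact hβδ.apply_apply_eq_zero h
  · obtain ⟨f, rfl⟩ := hρ g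
    exact ⟨N.mkQ f, rfl⟩
  · obtain ⟨f, rfl⟩ := N.mkQ_surjective x
    change ρ f = 0 ↔ _
    constructor
    · intro hf
      obtain ⟨y, rfl⟩ := (hκρ f).1 hf
      exact ⟨δ y, hi y⟩
    · rintro ⟨m, hm⟩
      obtain ⟨y, rfl⟩ := hδ m
      rw [hi] at hm
      obtain ⟨h, hh⟩ := (Submodule.Quotient.eq N).1 hm
      have hf : f = κ (y - β h) := by
        rw [map_sub, eq_sub_iff_add_eq, ← eq_sub_iff_add_eq']
        exact hh
      rw [hf]
      exact hκρ.apply_apply_eq_zero _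

/-- Over a GF-closed ring, a module of Gorenstein flat dimension at most `n` embeds, with
Gorenstein flat cokernel, into a module of flat dimension at most `n`. -/
theorem IsGFClosed.exists_embedding_flatDimLE (hS : IsGFClosed S) {n : ℕ} {M : ModuleCat.{u} S}
    (hM : gflatDimLE S n M) :
    ∃ (H G : ModuleCat.{u} S) (ι : M →ₗ[S] H) (π : H →ₗ[S] G),
      Function.Injective ι ∧ Function.Surjective π ∧ Function.Exact ι π ∧
      flatDimLE S n H ∧ IsGorensteinFlat S G := by
  induction n generalizing M with
  | zero => exact IsGorensteinFlat.exists_embedding_flat hM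
  | succ n ih =>
    obtain ⟨K, G, ι, π, hι, hπ, hex, hG, hK⟩ := hM
    obtain ⟨H, C, j, q, hj, hq, hjq, hH, hC⟩ := ih hK
    obtain ⟨P, α, γ, β, δ, ⟨hα, hγ, hαγ⟩, hβ, hδ, hβδ⟩ := exists_pushout hι hπ hex hj hq hjq
    obtain ⟨F, D, κ, ρ, hκ, hρ, hκρ, hF, hD⟩ :=
      (hS G P C α γ hα hγ hαγ hG hC).exists_embedding_flat
    obtain ⟨i, p, hi, hp, hip⟩ := exists_quotient_embedding hδ hβδ hκ hρ hκρ
    exact ⟨ModuleCat.of S (F ⧸ LinearMap.range (κ ∘ₗ β)), D, i, p, hi, hp, hip,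
      ⟨H, F, κ ∘ₗ β, (LinearMap.range (κ ∘ₗ β)).mkQ, hκ.comp hβ, Submodule.mkQ_surjective _,
        LinearMap.exact_map_mkQ_range _, hF, hH⟩, hD⟩

theorem IsGFClosed.flatDimLE_iff_gflatDimLE_of_injective (hS : IsGFClosed S)
    {M : ModuleCat.{u} S} (hM : Module.Injective S M) (n : ℕ) :
    flatDimLE S n M ↔ gflatDimLE S n M := by
  refine ⟨gflatDimLE_of_flatDimLE, fun h => ?_⟩
  obtain ⟨H, G, ι, π, hι, -, -, hH, -⟩ := hS.exists_embedding_flatDimLE h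
  obtain ⟨r, hr⟩ := hM.out ι hι LinearMap.id
  exact flatDimLE_of_retract ι r hr hH

end GorensteinFlat

/-- **Corollary 2.3.**  If `R` is a left GF-closed ring and `M` is an injective left
`R`-module, then `fd_R(M) = Gfd_R(M)`.  (The statement for injective right modules over a
right GF-closed ring is the instance of this theorem at the opposite ring `Rᵐᵒᵖ`.) -/
theorem flatDim_eq_gflatDim_of_injective (R : Type u) [Ring R]
    (h : IsGFClosed R) (M : ModuleCat.{u} R) (hM : Module.Injective R ↥M) :
    flatDim R M = gflatDim R M := by
  simp only [flatDim, gflatDim, h.flatDimLE_iff_gflatDimLE_of_injective hM]
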